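/- Let d ≥ 1, let p ∈ ℝ^d, let A : ℝ^d → ℝ be a Schwartz function, and for k > 0 define the WKB wave field u^k(x) = A(x) e^{i k p·x}. Then for every Schwartz test function ψ : ℝ^d × ℝ^d → ℂ, lim_{k → ∞} ∫_{ℝ^d}∫_{ℝ^d} W^k[u^k](x, v) ψ(x, v) dx dv = ∫_{ℝ^d} |A(x)|² ψ(x, p) dx. (That is, the Wigner transforms W^k[u^k] converge weakly to |A(x)|² δ(v − p).) -/

import Mathlib

open MeasureTheory Filter
open scoped RealInnerProductSpace

/-- The Wigner transform `W^k[f,g]` of two functions on `ℝ^d`. -/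
noncomputable def wigner {d : ℕ} (k : ℝ) (f g : EuclideanSpace ℝ (Fin d) → ℂ)
    (x v : EuclideanSpace ℝ (Fin d)) : ℂ :=
  (((2 * Real.pi) ^ (-(d : ℝ)) : ℝ) : ℂ) *
    ∫ y : EuclideanSpace ℝ (Fin d),
      Complex.exp (Complex.I * ((⟪v, y⟫ : ℝ) : ℂ)) * f (x - (2 * k)⁻¹ • y) *
        (starRingEnd ℂ) (g (x + (2 * k)⁻¹ • y))

/-- The WKB wave field `u^k(x) = A(x) e^{i k p·x}` with real Schwartz amplitude `A`. -/
noncomputable def wkbField {d : ℕ} (k : ℝ) (p : EuclideanSpace ℝ (Fin d))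
    (A : EuclideanSpace ℝ (Fin d) → ℝ) (x : EuclideanSpace ℝ (Fin d)) : ℂ :=
  ((A x : ℝ) : ℂ) * Complex.exp (Complex.I * (k : ℂ) * ((⟪p, x⟫ : ℝ) : ℂ))

open scoped SchwartzMap FourierTransform ContDiff

section Slice

variable {E V F : Type*} [NormedAddCommGroup E] [NormedSpace ℝ E] [NormedAddCommGroup V]
  [NormedSpace ℝ V] [NormedAddCommGroup F] [NormedSpace ℝ F]

theorem norm_iteratedFDeriv_prodMk_le {f : E × V → F} (hf : ContDiff ℝ ∞ f) (x : E) (v : V)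
    (n : ℕ) :
    ‖iteratedFDeriv ℝ n (fun w => f (x, w)) v‖ ≤ ‖iteratedFDeriv ℝ n f (x, v)‖ := by
  have hg : ContDiff ℝ ∞ (fun z : E × V => f ((x, 0) + z)) := by fun_prop
  have hfun : (fun w => f (x, w)) =
      (fun z : E × V => f ((x, 0) + z)) ∘ ContinuousLinearMap.inr ℝ E V := by
    ext w; simp
  rw [hfun, ContinuousLinearMap.iteratedFDeriv_comp_right _ hg v (mod_cast le_top),
    iteratedFDeriv_comp_add_left]
  refine (ContinuousMultilinearMap.norm_compContinuousLinearMap_le _ _).trans ?_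
  have hinr : ‖ContinuousLinearMap.inr ℝ E V‖ ≤ 1 :=
    ContinuousLinearMap.opNorm_le_bound _ zero_le_one (by simp [Prod.norm_def])
  simp only [ContinuousLinearMap.inr_apply, Prod.mk_add_mk, add_zero, zero_add]
  refine mul_le_of_le_one_right (norm_nonneg _) ?_
  exact Finset.prod_le_one (fun _ _ => norm_nonneg _) fun _ _ => hinr

/-- The partial function `ψ (x, ·)` of a Schwartz function `ψ` on a product space. -/
noncomputable def SchwartzMap.slice (ψ : 𝓢(E × V, F)) (x : E) : 𝓢(V, F) where
  toFun v := ψ (x, v)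
  smooth' := (ψ.smooth ⊤).comp (by fun_prop)
  decay' k n := by
    obtain ⟨C, hC⟩ := ψ.decay k n
    refine ⟨C, fun v => le_trans ?_ (hC.2 (x, v))⟩
    gcongr
    · simp [Prod.norm_def]
    · exact norm_iteratedFDeriv_prodMk_le (ψ.smooth ⊤) x v n

@[simp]
theorem SchwartzMap.slice_apply (ψ : 𝓢(E × V, F)) (x : E) (v : V) : ψ.slice x v = ψ (x, v) := rfl

theorem SchwartzMap.exists_seminorm_slice_le (ψ : 𝓢(E × V, ℂ)) (N k n : ℕ) :
    ∃ C, 0 ≤ C ∧ ∀ x, SchwartzMap.seminorm ℂ k n (ψ.slice x) ≤ C * ((1 + ‖x‖) ^ N)⁻¹ := by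
  set C := 2 ^ (N + k) *
    ((Finset.Iic (N + k, n)).sup fun m => SchwartzMap.seminorm ℂ m.1 m.2) ψ
  have hC : 0 ≤ C := by positivity
  refine ⟨C, hC, fun x => SchwartzMap.seminorm_le_bound _ _ _ _ (by positivity) fun v => ?_⟩
  rw [← div_eq_mul_inv, le_div_iff₀ (by positivity)]
  have hx : ‖x‖ ≤ ‖(x, v)‖ := by simp [Prod.norm_def]
  have hv : ‖v‖ ≤ 1 + ‖(x, v)‖ := by
    have : ‖v‖ ≤ ‖(x, v)‖ := by simp [Prod.norm_def]
    linarith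
  calc ‖v‖ ^ k * ‖iteratedFDeriv ℝ n (ψ.slice x) v‖ * (1 + ‖x‖) ^ N
      ≤ (1 + ‖(x, v)‖) ^ k * ‖iteratedFDeriv ℝ n ψ (x, v)‖ * (1 + ‖(x, v)‖) ^ N := by
        gcongr
        exact norm_iteratedFDeriv_prodMk_le (ψ.smooth ⊤) x v n
    _ = (1 + ‖(x, v)‖) ^ (N + k) * ‖iteratedFDeriv ℝ n ψ (x, v)‖ := by ring
    _ ≤ C := SchwartzMap.one_add_le_sup_seminorm_apply (𝕜 := ℂ) (m := (N + k, n)) le_rfl le_rfl ψ _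

end Slice

theorem SchwartzMap.exists_integral_norm_fourier_slice_le {E V : Type*} [NormedAddCommGroup E]
    [NormedSpace ℝ E] [NormedAddCommGroup V] [InnerProductSpace ℝ V] [FiniteDimensional ℝ V]
    [MeasurableSpace V] [BorelSpace V] (ψ : 𝓢(E × V, ℂ)) (N : ℕ) :
    ∃ C, 0 ≤ C ∧ ∀ x, ∫ w, ‖𝓕 (ψ.slice x) w‖ ≤ C * ((1 + ‖x‖) ^ N)⁻¹ := by
  obtain ⟨L, hL⟩ : ∃ L : 𝓢(V, ℂ) →L[ℂ] Lp ℂ 1 (volume : Measure V),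
      ∀ f, ‖L f‖ = ∫ w, ‖𝓕 f w‖ :=
    ⟨SchwartzMap.toLpCLM ℂ ℂ 1 volume ∘L SchwartzMap.fourierTransformCLM ℂ,
      fun f => SchwartzMap.norm_toLp_one (f := 𝓕 f)⟩
  let q : Seminorm ℂ 𝓢(V, ℂ) :=
    (normSeminorm ℂ (Lp ℂ 1 (volume : Measure V))).comp L.toLinearMap
  have hqL : ∀ f, q f = ‖L f‖ := fun f => rfl
  have hq : Continuous q := (continuous_congr hqL).2 L.continuous.norm
  obtain ⟨s, C, -, hC⟩ := Seminorm.bound_of_continuous (schwartz_withSeminorms ℂ V ℂ) q hq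
  choose c hc0 hc using fun m : ℕ × ℕ => ψ.exists_seminorm_slice_le N m.1 m.2
  have hsum : 0 ≤ ∑ m ∈ s, c m := Finset.sum_nonneg fun m _ => hc0 m
  refine ⟨C * ∑ m ∈ s, c m, by positivity, fun x => ?_⟩
  calc ∫ w, ‖𝓕 (ψ.slice x) w‖ = ‖L (ψ.slice x)‖ := (hL _).symm
    _ ≤ C * s.sup (schwartzSeminormFamily ℂ V ℂ) (ψ.slice x) := hC (ψ.slice x)
    _ ≤ C * ((∑ m ∈ s, c m) * ((1 + ‖x‖) ^ N)⁻¹) := by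
        gcongr
        refine Seminorm.finset_sup_apply_le (by positivity) fun m hm => (hc m x).trans ?_
        gcongr
        exact Finset.single_le_sum (fun m _ => hc0 m) hm
    _ = _ := by ring

section Wigner

variable {d : ℕ}

/-- The function of `w` whose Fourier transform is the Wigner transform of a WKB field at `x`,
at spatial scale `h`. -/
noncomputable def wkbCorrelation (h : ℝ) (p : EuclideanSpace ℝ (Fin d))
    (A : EuclideanSpace ℝ (Fin d) → ℝ) (x w : EuclideanSpace ℝ (Fin d)) : ℂ :=
  ((A (x + h • w) * A (x - h • w) : ℝ) : ℂ) * Complex.exp (2 * Real.pi * ⟪w, p⟫ * Complex.I)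

theorem wigner_wkbField_eq_fourier {k : ℝ} (hk : k ≠ 0) (p : EuclideanSpace ℝ (Fin d))
    (A : EuclideanSpace ℝ (Fin d) → ℝ) (x v : EuclideanSpace ℝ (Fin d)) :
    wigner k (wkbField k p A) (wkbField k p A) x v =
      𝓕 (wkbCorrelation (Real.pi * k⁻¹) p A x) v := by
  have hpi : (0 : ℝ) < 2 * Real.pi := by positivity
  have hscale (g : EuclideanSpace ℝ (Fin d) → ℂ) :
      (((2 * Real.pi) ^ (-(d : ℝ)) : ℝ) : ℂ) * ∫ y, g y = ∫ w, g ((-(2 * Real.pi)) • w) := by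
    rw [Measure.integral_comp_smul, finrank_euclideanSpace_fin, Real.rpow_neg hpi.le,
      Real.rpow_natCast, abs_inv, abs_pow, abs_neg, abs_of_pos hpi, Complex.real_smul]
  rw [wigner, hscale, Real.fourier_eq']
  congr 1 with w
  have h1 : x - (2 * k)⁻¹ • (-(2 * Real.pi)) • w = x + (Real.pi * k⁻¹) • w := by
    rw [smul_smul, sub_eq_add_neg, ← neg_smul]; congr 2; field_simp
  have h2 : x + (2 * k)⁻¹ • (-(2 * Real.pi)) • w = x - (Real.pi * k⁻¹) • w := by
    rw [smul_smul, sub_eq_add_neg, ← neg_smul]; congr 2; field_simp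
  have hk' : (k : ℂ) ≠ 0 := by exact_mod_cast hk
  rw [h1, h2, wkbField, wkbField, wkbCorrelation, map_mul, ← Complex.exp_conj, Complex.conj_ofReal,
    smul_eq_mul]
  simp only [map_mul, Complex.conj_I, Complex.conj_ofReal, inner_add_right, inner_sub_right,
    real_inner_smul_right, real_inner_comm w]
  have hexp : Complex.exp (Complex.I * ((-(2 * Real.pi) * ⟪w, v⟫ : ℝ) : ℂ)) *
      Complex.exp (Complex.I * k * ((⟪p, x⟫ + Real.pi * k⁻¹ * ⟪w, p⟫ : ℝ) : ℂ)) *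
      Complex.exp (-Complex.I * k * ((⟪p, x⟫ - Real.pi * k⁻¹ * ⟪w, p⟫ : ℝ) : ℂ)) =
      Complex.exp (((-2 * Real.pi * ⟪w, v⟫ : ℝ) : ℂ) * Complex.I) *
        Complex.exp (2 * Real.pi * ⟪w, p⟫ * Complex.I) := by
    simp only [← Complex.exp_add]
    congr 1
    push_cast
    field_simp
    ring
  push_cast at hexp ⊢
  linear_combination ((A (x + (Real.pi * k⁻¹) • w) : ℂ) * A (x - (Real.pi * k⁻¹) • w)) * hexp

theorem continuous_wkbCorrelation (h : ℝ) (p : EuclideanSpace ℝ (Fin d))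
    {A : EuclideanSpace ℝ (Fin d) → ℝ} (hA : Continuous A) (x : EuclideanSpace ℝ (Fin d)) :
    Continuous (wkbCorrelation h p A x) := by
  unfold wkbCorrelation
  fun_prop

theorem norm_wkbCorrelation (h : ℝ) (p : EuclideanSpace ℝ (Fin d))
    (A : EuclideanSpace ℝ (Fin d) → ℝ) (x w : EuclideanSpace ℝ (Fin d)) :
    ‖wkbCorrelation h p A x w‖ = ‖A (x + h • w)‖ * ‖A (x - h • w)‖ := by
  have hexp : ‖Complex.exp (2 * Real.pi * ⟪w, p⟫ * Complex.I)‖ = 1 := by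
    exact_mod_cast Complex.norm_exp_ofReal_mul_I (2 * Real.pi * ⟪w, p⟫)
  rw [wkbCorrelation, norm_mul, hexp, mul_one, Complex.norm_real, norm_mul]

theorem norm_wkbCorrelation_le (h : ℝ) (p : EuclideanSpace ℝ (Fin d))
    {A : EuclideanSpace ℝ (Fin d) → ℝ} {M : ℝ} (hM : ∀ x, ‖A x‖ ≤ M)
    (x w : EuclideanSpace ℝ (Fin d)) :
    ‖wkbCorrelation h p A x w‖ ≤ M ^ 2 := by
  rw [norm_wkbCorrelation, sq]
  exact mul_le_mul (hM _) (hM _) (norm_nonneg _) ((norm_nonneg _).trans (hM x))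

theorem integrable_wkbCorrelation {h : ℝ} (hh : h ≠ 0) (p : EuclideanSpace ℝ (Fin d))
    (A : 𝓢(EuclideanSpace ℝ (Fin d), ℝ)) (x : EuclideanSpace ℝ (Fin d)) :
    Integrable (wkbCorrelation h p A x) := by
  have hint : Integrable fun w => A (x - h • w) :=
    (A.integrable.comp_sub_left x).comp_smul hh
  refine (hint.norm.const_mul (SchwartzMap.seminorm ℝ 0 0 A)).mono'
    (continuous_wkbCorrelation h p A.continuous x).aestronglyMeasurable (.of_forall fun w => ?_)
  rw [norm_wkbCorrelation]
  gcongr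
  exact A.norm_le_seminorm ℝ _

theorem integral_wigner_wkbField_mul {k : ℝ} (hk : k ≠ 0) (p : EuclideanSpace ℝ (Fin d))
    (A : 𝓢(EuclideanSpace ℝ (Fin d), ℝ)) (f : 𝓢(EuclideanSpace ℝ (Fin d), ℂ))
    (x : EuclideanSpace ℝ (Fin d)) :
    ∫ v, wigner k (wkbField k p A) (wkbField k p A) x v * f v =
      ∫ w, wkbCorrelation (Real.pi * k⁻¹) p A x w * 𝓕 f w := by
  simp only [wigner_wkbField_eq_fourier hk]
  simpa using! VectorFourier.integral_bilin_fourierIntegral_eq_flip (.mul ℂ ℂ)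
    (L := innerₗ (EuclideanSpace ℝ (Fin d))) Real.continuous_fourierChar continuous_inner
    (integrable_wkbCorrelation (mul_ne_zero Real.pi_ne_zero (inv_ne_zero hk)) p A x) f.integrable

theorem continuous_wkbField (k : ℝ) (p : EuclideanSpace ℝ (Fin d))
    {A : EuclideanSpace ℝ (Fin d) → ℝ} (hA : Continuous A) : Continuous (wkbField k p A) := by
  unfold wkbField
  fun_prop

theorem stronglyMeasurable_wigner (k : ℝ) {f g : EuclideanSpace ℝ (Fin d) → ℂ}
    (hf : Continuous f) (hg : Continuous g) :
    StronglyMeasurable fun z : EuclideanSpace ℝ (Fin d) × EuclideanSpace ℝ (Fin d) =>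
      wigner k f g z.1 z.2 := by
  refine StronglyMeasurable.const_mul (StronglyMeasurable.integral_prod_right ?_) _
  refine Continuous.stronglyMeasurable ?_
  unfold Function.uncurry
  fun_prop

theorem tendsto_integral_wkbCorrelation_mul (p : EuclideanSpace ℝ (Fin d))
    (A : 𝓢(EuclideanSpace ℝ (Fin d), ℝ)) (f : 𝓢(EuclideanSpace ℝ (Fin d), ℂ))
    (x : EuclideanSpace ℝ (Fin d)) :
    Tendsto (fun h : ℝ => ∫ w, wkbCorrelation h p A x w * 𝓕 f w) (nhds 0)
      (nhds (((A x ^ 2 : ℝ) : ℂ) * f p)) := by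
  have hlim : ∫ w, wkbCorrelation 0 p A x w * 𝓕 f w = ((A x ^ 2 : ℝ) : ℂ) * f p := by
    have hinv : f p = 𝓕⁻ (⇑(𝓕 f : 𝓢(EuclideanSpace ℝ (Fin d), ℂ))) p := by
      rw [← SchwartzMap.fourierInv_coe, FourierTransform.fourierInv_fourier_eq]
    rw [hinv, Real.fourierInv_eq', ← integral_const_mul]
    congr 1 with w
    simp [wkbCorrelation]
    ring
  rw [← hlim]
  refine tendsto_integral_filter_of_dominated_convergence
    (fun w => (SchwartzMap.seminorm ℝ 0 0 A) ^ 2 * ‖𝓕 f w‖) (.of_forall fun h => ?_)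
    (.of_forall fun h => .of_forall fun w => ?_) ((𝓕 f).integrable.norm.const_mul _)
    (.of_forall fun w => ?_)
  · exact ((continuous_wkbCorrelation h p A.continuous x).mul
      (𝓕 f).continuous).aestronglyMeasurable
  · rw [norm_mul]
    gcongr
    exact norm_wkbCorrelation_le h p (A.norm_le_seminorm ℝ) x w
  · refine Continuous.tendsto (f := fun h : ℝ => wkbCorrelation h p A x w * 𝓕 f w) ?_ 0
    have := A.continuous
    unfold wkbCorrelation
    fun_prop

end Wigner

/-- the Wigner transforms of the WKB fields `u^k(x) = A(x) e^{i k p·x}`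
converge weakly to `|A(x)|² δ(v - p)`: for every Schwartz test function `ψ` on phase space,
`lim_{k→∞} ∫∫ W^k[u^k](x,v) ψ(x,v) dx dv = ∫ |A(x)|² ψ(x,p) dx`. -/
theorem wigner_wkb_weak_limit (d : ℕ) (hd : 1 ≤ d) (p : EuclideanSpace ℝ (Fin d))
    (A : SchwartzMap (EuclideanSpace ℝ (Fin d)) ℝ)
    (ψ : SchwartzMap (EuclideanSpace ℝ (Fin d) × EuclideanSpace ℝ (Fin d)) ℂ) :
    Tendsto (fun k : ℝ =>
        ∫ x : EuclideanSpace ℝ (Fin d), ∫ v : EuclideanSpace ℝ (Fin d),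
          wigner k (wkbField k p (⇑A)) (wkbField k p (⇑A)) x v * ψ (x, v))
      atTop
      (nhds (∫ x : EuclideanSpace ℝ (Fin d), (((A x) ^ 2 : ℝ) : ℂ) * ψ (x, p))) := by
  obtain ⟨C, -, hC⟩ := ψ.exists_integral_norm_fourier_slice_le (d + 1)
  set M := SchwartzMap.seminorm ℝ 0 0 A
  have hscale : Tendsto (fun k : ℝ => Real.pi * k⁻¹) atTop (nhds 0) := by
    simpa using tendsto_inv_atTop_zero.const_mul Real.pi
  refine tendsto_integral_filter_of_dominated_convergence
    (fun x => M ^ 2 * (C * ((1 + ‖x‖) ^ (d + 1))⁻¹)) (.of_forall fun k => ?_) ?_ ?_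
    (.of_forall fun x => ?_)
  · have hu := continuous_wkbField k p A.continuous
    exact (StronglyMeasurable.integral_prod_right'
      ((stronglyMeasurable_wigner k hu hu).mul
        ψ.continuous.stronglyMeasurable)).aestronglyMeasurable
  · filter_upwards [eventually_ne_atTop 0] with k hk
    refine .of_forall fun x => ?_
    have hslice := integral_wigner_wkbField_mul hk p A (ψ.slice x) x
    simp only [SchwartzMap.slice_apply] at hslice
    rw [hslice]
    calc ‖∫ w, wkbCorrelation (Real.pi * k⁻¹) p A x w * 𝓕 (ψ.slice x) w‖
        ≤ ∫ w, M ^ 2 * ‖𝓕 (ψ.slice x) w‖ := by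
          refine norm_integral_le_of_norm_le ((𝓕 (ψ.slice x)).integrable.norm.const_mul _)
            (.of_forall fun w => ?_)
          rw [norm_mul]
          gcongr
          exact norm_wkbCorrelation_le _ p (A.norm_le_seminorm ℝ) x w
      _ ≤ M ^ 2 * (C * ((1 + ‖x‖) ^ (d + 1))⁻¹) := by
          rw [integral_const_mul]
          gcongr
          exact hC x
  · refine Integrable.const_mul (Integrable.const_mul ?_ C) _
    have hdim : (Module.finrank ℝ (EuclideanSpace ℝ (Fin d)) : ℝ) < ((d + 1 : ℕ) : ℝ) := by simp
    refine (integrable_one_add_norm hdim).congr (.of_forall fun x => ?_)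
    simp only
    rw [Real.rpow_neg (by positivity), Real.rpow_natCast]
  · refine ((tendsto_integral_wkbCorrelation_mul p A (ψ.slice x) x).comp hscale).congr' ?_
    filter_upwards [eventually_ne_atTop 0] with k hk
    exact (integral_wigner_wkbField_mul hk p A (ψ.slice x) x).symm
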